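/- Let P be a simple polygon and W a witness set of P; assume Vis(u) equals the closure of its interior for every u ∈ W. Let w, v ∈ W be adjacent in GCon(W), let NV be a connected component of NVis(W) attached to both Vis(w) and Vis(v), let e_w be a window of Vis(w) with e_w ⊆ closure(NV), and let e_v be a window of Vis(v) with e_v ⊆ closure(NV). Then every neighbor witness path between w and v (the image of a continuous path from w to v contained in Vis(w) ∪ NVis(W) ∪ Vis(v)) intersects both e_w and e_v. -/

import Mathlib

open Set

noncomputable section

abbrev Plane := EuclideanSpace ℝ (Fin 2)

/-- A simple polygon, given by a cyclic sequence of at least three distinct vertices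
whose closed polygonal boundary curve is a Jordan polygon: two edges intersect exactly
when they are consecutive, and then only in their one shared endpoint. -/
structure SimplePolygon where
  n : ℕ
  three_le : 3 ≤ n
  vertex : ℕ → Plane
  periodic : ∀ i, vertex (i + n) = vertex i
  inj : ∀ i < n, ∀ j < n, vertex i = vertex j → i = j
  jordan : ∀ i < n, ∀ j < n, i ≠ j →
    segment ℝ (vertex i) (vertex (i + 1)) ∩ segment ℝ (vertex j) (vertex (j + 1)) =
      if j = (i + 1) % n then {vertex (i + 1)}
      else if i = (j + 1) % n then {vertex (j + 1)}
      else ∅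

namespace SimplePolygon

/-- The boundary curve of the polygon: the union of its edges. -/
def boundary (P : SimplePolygon) : Set Plane :=
  ⋃ i ∈ Finset.range P.n, segment ℝ (P.vertex i) (P.vertex (i + 1))

/-- The polygon as a region: the boundary together with all bounded connected
components of the complement of the boundary. -/
def region (P : SimplePolygon) : Set Plane :=
  P.boundary ∪ {x | x ∉ P.boundary ∧
    Bornology.IsBounded (connectedComponentIn P.boundaryᶜ x)}

/-- Visibility region of a point `p`: all points `q` of the polygon such that the
closed segment `[p,q]` is contained in the polygon. -/
def Vis (P : SimplePolygon) (p : Plane) : Set Plane :=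
  {q | q ∈ P.region ∧ segment ℝ p q ⊆ P.region}

/-- Visibility region of a set. -/
def VisSet (P : SimplePolygon) (S : Set Plane) : Set Plane :=
  ⋃ p ∈ S, P.Vis p

/-- Two points of the polygon are visible to each other if the segment joining them
lies in the polygon. -/
def Visible (P : SimplePolygon) (p q : Plane) : Prop :=
  p ∈ P.region ∧ q ∈ P.region ∧ segment ℝ p q ⊆ P.region

/-- A witness set: a finite set of points of the polygon with pairwise disjoint
visibility regions. -/
def IsWitnessSet (P : SimplePolygon) (W : Set Plane) : Prop :=
  W.Finite ∧ W ⊆ P.region ∧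
    ∀ x ∈ W, ∀ y ∈ W, x ≠ y → P.Vis x ∩ P.Vis y = ∅

/-- The non-visible region of a witness set. -/
def NVis (P : SimplePolygon) (W : Set Plane) : Set Plane :=
  P.region \ ⋃ w ∈ W, P.Vis w

/-- `Vis p` is regular (has no arms) if it equals the closure of its interior. -/
def VisRegular (P : SimplePolygon) (p : Plane) : Prop :=
  P.Vis p = closure (interior (P.Vis p))

/-- A window of `Vis p`: a non-degenerate closed segment contained in the frontier of
`Vis p` whose intersection with the frontier of the polygon is exactly its two
endpoints, maximal with these properties. -/
def IsWindow (P : SimplePolygon) (p : Plane) (e : Set Plane) : Prop :=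
  ∃ a b : Plane, a ≠ b ∧ e = segment ℝ a b ∧
    e ⊆ frontier (P.Vis p) ∧
    e ∩ frontier P.region = {a, b} ∧
    ∀ a' b' : Plane, a' ≠ b' →
      segment ℝ a' b' ⊆ frontier (P.Vis p) →
      segment ℝ a' b' ∩ frontier P.region = {a', b'} →
      e ⊆ segment ℝ a' b' → e = segment ℝ a' b'

/-- `γ` is (the image of) a neighbor witness path between `w` and `w'`. -/
def IsNWPath (P : SimplePolygon) (W : Set Plane) (w w' : Plane) (γ : Set Plane) : Prop :=
  ∃ f : Path w w', γ = Set.range f ∧ γ ⊆ P.Vis w ∪ P.NVis W ∪ P.Vis w'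

/-- Adjacency in the neighbor witness graph `GCon(W)`. -/
def GConAdj (P : SimplePolygon) (W : Set Plane) (w w' : Plane) : Prop :=
  w ∈ W ∧ w' ∈ W ∧ w ≠ w' ∧ ∃ γ : Set Plane, P.IsNWPath W w w' γ

/-- A connected component `NV` of `NVis W` is attached to `Vis w` if the closure of
`NV` intersects `Vis w`. -/
def Attached (P : SimplePolygon) (NV : Set Plane) (w : Plane) : Prop :=
  (closure NV ∩ P.Vis w).Nonempty

/-- `w` is a simplicial vertex of `GCon(W)`: its neighbors are pairwise adjacent. -/
def Simplicial (P : SimplePolygon) (W : Set Plane) (w : Plane) : Prop :=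
  ∀ u v : Plane, P.GConAdj W w u → P.GConAdj W w v → u ≠ v → P.GConAdj W u v

end SimplePolygon

/-- `NV` is a connected component of `S`. -/
def IsCompOf (NV S : Set Plane) : Prop :=
  ∃ x ∈ S, NV = connectedComponentIn S x

theorem exists_continuousOn_log_div {K V : Set ℂ} (hK : IsCompact K) (hV : IsPreconnected V)
    (hKV : Disjoint K V) {a b : ℂ} (ha : a ∈ V) (hb : b ∈ V) :
    ∃ g : ℂ → ℂ, ContinuousOn g K ∧ ∀ z ∈ K, Complex.exp (g z) = (z - a) / (z - b) := by
  have hne : ∀ c ∈ V, ∀ z ∈ K, z - c ≠ 0 := fun c hc z hz h =>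
    hKV.ne_of_mem hz hc (sub_eq_zero.mp h)
  have symm : ∀ x y : ℂ, (∃ g : ℂ → ℂ, ContinuousOn g K ∧
      ∀ z ∈ K, Complex.exp (g z) = (z - x) / (z - y)) → ∃ g : ℂ → ℂ, ContinuousOn g K ∧
      ∀ z ∈ K, Complex.exp (g z) = (z - y) / (z - x) := by
    rintro x y ⟨g, hg, hgz⟩
    exact ⟨fun z => -g z, hg.neg, fun z hz => by rw [Complex.exp_neg, hgz z hz, inv_div]⟩
  refine hV.induction₂' (fun x y => ∃ g : ℂ → ℂ, ContinuousOn g K ∧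
    ∀ z ∈ K, Complex.exp (g z) = (z - x) / (z - y)) ?_ ?_ ha hb
  · intro x hx
    obtain ⟨r, hr, hrK⟩ := Metric.isOpen_iff.mp hK.isClosed.isOpen_compl x
      (disjoint_right.mp hKV hx)
    filter_upwards [inter_mem_nhdsWithin V (Metric.ball_mem_nhds x hr)] with y hy
    have key : ∃ g : ℂ → ℂ, ContinuousOn g K ∧
        ∀ z ∈ K, Complex.exp (g z) = (z - y) / (z - x) := by
      refine ⟨fun z => Complex.log ((z - y) / (z - x)), ?_, fun z hz =>
        Complex.exp_log (div_ne_zero (hne y hy.1 z hz) (hne x hx z hz))⟩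
      refine ContinuousOn.clog ((continuousOn_id.sub continuousOn_const).div
        (continuousOn_id.sub continuousOn_const) (hne x hx)) fun z hz => ?_
      have h1 : (z - y) / (z - x) = 1 + (x - y) / (z - x) := by
        field_simp [hne x hx z hz]; ring
      change (z - y) / (z - x) ∈ _
      rw [h1]
      apply Complex.mem_slitPlane_of_norm_lt_one
      rw [norm_div, div_lt_one (norm_pos_iff.mpr (hne x hx z hz))]
      have h2 : r ≤ dist z x := by
        by_contra h
        exact hrK (Metric.mem_ball.mpr (not_le.mp h)) hz
      have h3 := Metric.mem_ball.mp hy.2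
      rw [dist_comm, dist_eq_norm] at h3
      rw [dist_eq_norm] at h2
      linarith
    exact ⟨symm _ _ key, key⟩
  · rintro x y t hx hy ht ⟨g, hg, hgz⟩ ⟨k, hk, hkz⟩
    refine ⟨fun z => g z + k z, hg.add hk, fun z hz => ?_⟩
    rw [Complex.exp_add, hgz z hz, hkz z hz]
    field_simp [hne y hy z hz, hne t ht z hz]

theorem eq_of_continuousOn_of_exp_eq {K : Set ℂ} (hK : IsPreconnected K) {g k : ℂ → ℂ}
    (hg : ContinuousOn g K) (hk : ContinuousOn k K) {c : ℂ}
    (h : ∀ z ∈ K, Complex.exp (g z - k z) = c) {p q : ℂ} (hp : p ∈ K) (hq : q ∈ K) :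
    g p - k p = g q - k q := by
  have key : ∀ z ∈ K, ∃ n : ℤ, (g z - k z) = g p - k p + n * (2 * Real.pi * Complex.I) :=
    fun z hz => Complex.exp_eq_exp_iff_exists_int.mp ((h z hz).trans (h p hp).symm)
  have hpi : (2 * Real.pi * Complex.I) ≠ 0 := Complex.two_pi_I_ne_zero
  have hc : ContinuousOn (fun z => ((g z - k z) - (g p - k p)) / (2 * Real.pi * Complex.I)) K :=
    ((hg.sub hk).sub continuousOn_const).div_const _
  have hT : IsDiscrete (range ((↑) : ℤ → ℂ)) := by
    have h := Complex.isometry_ofReal.isEmbedding.comp Int.isClosedEmbedding_coe_real.isEmbedding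
    convert h.isDiscrete_range using 2
    ext n; simp
  have h0 := hK.constant_of_mapsTo hT hc (fun z hz => by
    obtain ⟨n, hn⟩ := key z hz
    refine ⟨n, ?_⟩
    beta_reduce
    rw [hn]; field_simp; ring) hp hq
  simp only [sub_self, zero_div] at h0
  rw [eq_comm, div_eq_zero_iff, sub_eq_zero] at h0
  exact (h0.resolve_right hpi).symm

theorem crosscut_separates {R : Set ℂ} (hR : IsPreconnected Rᶜ) {a b x p q : ℂ}
    (ha : a ∈ frontier R) (hb : b ∈ frontier R) {D : Set ℂ} (hD : Convex ℝ D)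
    (hDR : D ⊆ interior R) (hx : x ∈ D) (hxab : x ∈ openSegment ℝ a b) (hp : p ∈ D) (hq : q ∈ D)
    (hpi : 0 < (p - a).im * (p - b).re - (p - a).re * (p - b).im)
    (hqi : (q - a).im * (q - b).re - (q - a).re * (q - b).im < 0) :
    ¬ JoinedIn (R \ segment ℝ a b) p q := by
  rintro ⟨γ, hγ⟩
  have haD : a ∉ D := fun h => ha.2 (hDR h)
  have hbD : b ∉ D := fun h => hb.2 (hDR h)
  have hpqD : segment ℝ p q ⊆ D := hD.segment_subset hp hq
  have hKV : Disjoint (range γ ∪ segment ℝ p q) (Rᶜ ∪ {a, b}) := by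
    rw [disjoint_left]
    rintro z (⟨t, rfl⟩ | hz) (h | rfl | rfl)
    · exact h (hγ t).1
    · exact (hγ t).2 (left_mem_segment ℝ _ _)
    · exact (hγ t).2 (right_mem_segment ℝ _ _)
    · exact h (interior_subset (hDR (hpqD hz)))
    · exact haD (hpqD hz)
    · exact hbD (hpqD hz)
  have hV : IsPreconnected (Rᶜ ∪ {a, b}) := by
    refine hR.subset_closure subset_union_left (union_subset subset_closure ?_)
    rw [← frontier_compl] at ha hb
    rintro z (rfl | rfl)
    exacts [ha.1, hb.1]
  have hsegc : IsCompact (segment ℝ p q) := by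
    rw [segment_eq_image]
    exact isCompact_Icc.image (by fun_prop)
  obtain ⟨g, hg, hgz⟩ := exists_continuousOn_log_div ((isCompact_range γ.continuous).union hsegc)
    hV hKV (a := a) (b := b) (by simp) (by simp)
  have hne : ∀ z ∈ range γ ∪ segment ℝ p q, z - a ≠ 0 ∧ z - b ≠ 0 := fun z hz =>
    ⟨fun h => hKV.ne_of_mem hz (Or.inr (Or.inl rfl)) (sub_eq_zero.mp h),
      fun h => hKV.ne_of_mem hz (Or.inr (Or.inr rfl)) (sub_eq_zero.mp h)⟩
  have hfc : ContinuousOn (fun z => (z - a) / (z - b)) (range γ ∪ segment ℝ p q) :=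
    (continuousOn_id.sub continuousOn_const).div (continuousOn_id.sub continuousOn_const)
      fun z hz => (hne z hz).2
  have hreal : ∀ z ∈ range γ ∪ segment ℝ p q, ((z - a) / (z - b)).im = 0 →
      z - a = (((z - a) / (z - b)).re : ℂ) * (z - b) := by
    intro z hz him
    have h1 : (z - a) / (z - b) = (((z - a) / (z - b)).re : ℂ) := by
      apply Complex.ext <;> simp [him]
    rw [← h1, div_mul_cancel₀ _ (hne z hz).2]
  have hs1 : ∀ z ∈ range γ, (z - a) / (z - b) ∈ Complex.slitPlane := by
    rintro z hz
    by_contra hcon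
    rw [Complex.mem_slitPlane_iff, not_or, not_lt, not_not] at hcon
    have h := hreal z (Or.inl hz) hcon.2
    set r := ((z - a) / (z - b)).re
    obtain ⟨t, rfl⟩ := hz
    refine (hγ t).2 ⟨1 / (1 - r), -r / (1 - r), by apply div_nonneg <;> linarith,
      by apply div_nonneg <;> linarith, ?_, ?_⟩
    · field_simp [show 1 - r ≠ 0 by linarith]; ring
    · have h1r : (1 - (r : ℂ)) ≠ 0 := by
        exact_mod_cast show 1 - r ≠ 0 by linarith
      simp only [Complex.real_smul]
      push_cast
      field_simp
      linear_combination -h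
  have hs2 : ∀ z ∈ segment ℝ p q, -((z - a) / (z - b)) ∈ Complex.slitPlane := by
    intro z hz
    by_contra hcon
    rw [Complex.mem_slitPlane_iff, not_or, not_lt, not_not, Complex.neg_re, Complex.neg_im,
      neg_eq_zero, neg_nonpos] at hcon
    have h := hreal z (Or.inr hz) hcon.2
    have hr0 := hcon.1
    set r := ((z - a) / (z - b)).re
    obtain ⟨u, v, hu, hv, huv, rfl⟩ := hxab
    rcases lt_trichotomy r 1 with hr | hr | hr
    · have hpos : 0 < v + r * u := by positivity
      refine haD (?_ : a ∈ D)
      have := hD (hpqD hz) hx (a := v * (1 - r) / (v + r * u)) (b := r / (v + r * u))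
        (by have : 0 ≤ 1 - r := by linarith
            positivity) (by positivity) (by field_simp; linear_combination -r * huv)
      convert this using 1
      have : ((v : ℂ) + r * u) ≠ 0 := by exact_mod_cast hpos.ne'
      simp only [Complex.real_smul]
      push_cast
      field_simp
      linear_combination -v * h
    · rw [hr] at h
      have hab : a = b := by push_cast at h; linear_combination -h
      rw [hab] at hpi
      linarith
    · have hpos : 0 < u * r + v := by positivity
      refine hbD (?_ : b ∈ D)
      have := hD (hpqD hz) hx (a := u * (r - 1) / (u * r + v)) (b := 1 / (u * r + v))
        (by have : 0 ≤ r - 1 := by linarith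
            positivity) (by positivity) (by field_simp; linear_combination -huv)
      convert this using 1
      have : ((u : ℂ) * r + v) ≠ 0 := by exact_mod_cast hpos.ne'
      simp only [Complex.real_smul]
      push_cast
      field_simp
      linear_combination u * h
  have e1 := eq_of_continuousOn_of_exp_eq (isPreconnected_range γ.continuous)
    (hg.mono subset_union_left) (ContinuousOn.clog (hfc.mono subset_union_left) hs1) (c := 1)
    (fun z hz => by
      rw [Complex.exp_sub, hgz z (Or.inl hz), Complex.exp_log (Complex.slitPlane_ne_zero (hs1 z hz)),
        div_self (Complex.slitPlane_ne_zero (hs1 z hz))]) ⟨0, γ.source⟩ ⟨1, γ.target⟩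
  have e2 := eq_of_continuousOn_of_exp_eq (convex_segment p q).isPreconnected
    (hg.mono subset_union_right) (ContinuousOn.clog (hfc.mono subset_union_right).neg hs2)
    (c := -1) (fun z hz => by
      have h := Complex.slitPlane_ne_zero (hs2 z hz)
      rw [Complex.exp_sub, hgz z (Or.inr hz), Pi.neg_apply, Complex.exp_log h, div_neg,
        div_self (neg_ne_zero.mp h)]) (left_mem_segment ℝ p q) (right_mem_segment ℝ p q)
  have him : ∀ z, ((z - a) / (z - b)).im =
      ((z - a).im * (z - b).re - (z - a).re * (z - b).im) / Complex.normSq (z - b) := by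
    intro z
    rw [Complex.div_im]; ring
  have hpos : ∀ z ∈ range γ, 0 < Complex.normSq (z - b) := fun z hz =>
    Complex.normSq_pos.mpr (hne z (Or.inl hz)).2
  have h1 : 0 < ((p - a) / (p - b)).im := by
    rw [him]; exact div_pos hpi (hpos p ⟨0, γ.source⟩)
  have h2 : ((q - a) / (q - b)).im < 0 := by
    rw [him]; exact div_neg_of_neg_of_pos hqi (hpos q ⟨1, γ.target⟩)
  have a1 := Complex.arg_neg_eq_arg_sub_pi_of_im_pos h1
  have a2 := Complex.arg_neg_eq_arg_add_pi_of_im_neg h2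
  have i1 := congrArg Complex.im e1
  have i2 := congrArg Complex.im e2
  simp only [Complex.sub_im, Complex.log_im, Pi.neg_apply] at i1 i2 
  have := Real.pi_pos
  linarith

theorem isPreconnected_compl_closedBall {E : Type*} [NormedAddCommGroup E] [NormedSpace ℝ E]
    (hE : 1 < Module.rank ℝ E) {r : ℝ} (hr : 0 ≤ r) :
    IsPreconnected (Metric.closedBall (0 : E) r)ᶜ := by
  have h := ((isPreconnected_sphere hE (0 : E) 1).prod (isPreconnected_Ioi (a := r))).image
    (fun z : E × ℝ => z.2 • z.1) (by fun_prop)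
  convert h using 1
  ext x
  simp only [mem_compl_iff, Metric.mem_closedBall, dist_zero_right, not_le, mem_image, mem_prod,
    mem_sphere_iff_norm, sub_zero, mem_Ioi, Prod.exists]
  constructor
  · intro hx
    have hx0 : ‖x‖ ≠ 0 := by linarith
    exact ⟨‖x‖⁻¹ • x, ‖x‖, ⟨by rw [norm_smul, norm_inv, norm_norm, inv_mul_cancel₀ hx0], hx⟩,
      by rw [smul_inv_smul₀ hx0]⟩
  · rintro ⟨y, t, ⟨hy, ht⟩, rfl⟩
    rw [norm_smul, hy, mul_one, Real.norm_of_nonneg (by linarith)]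
    exact ht

theorem one_lt_rank_plane : 1 < Module.rank ℝ Plane := by
  rw [← Module.finrank_eq_rank, finrank_euclideanSpace_fin]
  norm_num

theorem isCompact_segment {E : Type*} [NormedAddCommGroup E] [NormedSpace ℝ E] (a b : E) :
    IsCompact (segment ℝ a b) := by
  rw [segment_eq_image]
  exact isCompact_Icc.image (by fun_prop)

theorem not_isBounded_compl {R : Set Plane} (hR : Bornology.IsBounded R) :
    ¬ Bornology.IsBounded Rᶜ := fun h => by
  have := hR.union h
  rw [union_compl_self] at this
  exact NormedSpace.unbounded_univ ℝ Plane this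

namespace SimplePolygon

theorem isCompact_boundary (P : SimplePolygon) : IsCompact P.boundary :=
  (Finset.range P.n).isCompact_biUnion fun _ _ => isCompact_segment _ _

/-- The exterior of the polygon is a single component of the complement of its boundary. -/
theorem exists_compl_region_eq (P : SimplePolygon) :
    ∃ y r, P.regionᶜ = connectedComponentIn P.boundaryᶜ y ∧
      (Metric.closedBall (0 : Plane) r)ᶜ ⊆ P.regionᶜ := by
  obtain ⟨r, hr, hB⟩ := P.isCompact_boundary.isBounded.subset_closedBall_lt 0 0
  have hE := isPreconnected_compl_closedBall one_lt_rank_plane hr.le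
  have hEB := compl_subset_compl.mpr hB
  have hunb := not_isBounded_compl (Metric.isBounded_closedBall (x := (0 : Plane)) (r := r))
  have hEne : (Metric.closedBall (0 : Plane) r)ᶜ.Nonempty := by
    by_contra h
    rw [not_nonempty_iff_eq_empty] at h
    exact hunb (h ▸ Bornology.isBounded_empty)
  obtain ⟨y, hy⟩ := hEne
  have hEy : (Metric.closedBall (0 : Plane) r)ᶜ ⊆ connectedComponentIn P.boundaryᶜ y :=
    hE.subset_connectedComponentIn hy hEB
  have heq : P.regionᶜ = connectedComponentIn P.boundaryᶜ y := by
    ext z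
    simp only [region, mem_compl_iff, mem_union, mem_ofPred_eq, not_or, not_and]
    constructor
    · rintro ⟨hz, hzb⟩
      obtain ⟨z', hz', hzr⟩ := not_subset.mp
        fun h => hzb hz ((Metric.isBounded_closedBall (x := (0 : Plane)) (r := r)).subset h)
      have hyz := hE.subset_connectedComponentIn hzr hEB hy
      rw [← connectedComponentIn_eq hz'] at hyz
      rw [← connectedComponentIn_eq hyz]
      exact mem_connectedComponentIn hz
    · intro hz
      refine ⟨connectedComponentIn_subset _ _ hz, fun _ hb => hunb ?_⟩
      rw [← connectedComponentIn_eq hz] at hb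
      exact hb.subset hEy
  exact ⟨y, r, heq, heq ▸ hEy⟩

theorem isPreconnected_compl_region (P : SimplePolygon) : IsPreconnected P.regionᶜ := by
  obtain ⟨y, r, h, -⟩ := P.exists_compl_region_eq
  exact h ▸ isPreconnected_connectedComponentIn

theorem isClosed_region (P : SimplePolygon) : IsClosed P.region := by
  obtain ⟨y, r, h, -⟩ := P.exists_compl_region_eq
  rw [← isOpen_compl_iff, h]
  exact P.isCompact_boundary.isClosed.isOpen_compl.connectedComponentIn

theorem isBounded_region (P : SimplePolygon) : Bornology.IsBounded P.region := by
  obtain ⟨y, r, -, h⟩ := P.exists_compl_region_eq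
  exact Metric.isBounded_closedBall.subset (compl_subset_compl.mp h)

/-- Near each of its points, the polygon is star-shaped with respect to that point. -/
theorem exists_ball_segment_subset_region (P : SimplePolygon) (x : Plane) :
    ∃ r > 0, ∀ y ∈ Metric.ball x r, y ∈ P.region → segment ℝ x y ⊆ P.region := by
  classical
  let F : Set Plane := ⋃ i ∈ (Finset.range P.n).filter
    (fun i => x ∉ segment ℝ (P.vertex i) (P.vertex (i + 1))),
      segment ℝ (P.vertex i) (P.vertex (i + 1))
  have hF : IsClosed F :=
    (Finset.isCompact_biUnion _ fun _ _ => isCompact_segment _ _).isClosed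
  have hxF : x ∈ Fᶜ := by
    simp only [F, mem_compl_iff, mem_iUnion, Finset.mem_filter, not_exists]
    exact fun i hi => hi.2
  obtain ⟨r, hr, hrF⟩ := Metric.isOpen_iff.mp hF.isOpen_compl x hxF
  refine ⟨r, hr, fun y hy hyR u hu => ?_⟩
  have hball : segment ℝ x y ⊆ Metric.ball x r :=
    (convex_ball x r).segment_subset (Metric.mem_ball_self hr) hy
  have hcone : ∀ z ∈ segment ℝ x y, z ∈ P.boundary → segment ℝ x z ⊆ P.boundary := by
    intro z hz hzB
    simp only [boundary, mem_iUnion] at hzB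
    obtain ⟨i, hi, hzi⟩ := hzB
    have hxi : x ∈ segment ℝ (P.vertex i) (P.vertex (i + 1)) := by
      by_contra hxi
      refine hrF (hball hz) ?_
      simp only [F, mem_iUnion]
      exact ⟨i, Finset.mem_filter.mpr ⟨hi, hxi⟩, hzi⟩
    exact ((convex_segment _ _).segment_subset hxi hzi).trans
      (subset_biUnion_of_mem (u := fun i => segment ℝ (P.vertex i) (P.vertex (i + 1))) hi)
  by_cases hmeet : ∃ z ∈ segment ℝ u y, z ∈ P.boundary
  · obtain ⟨z, hz, hzB⟩ := hmeet
    have hzxy : z ∈ segment ℝ x y :=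
      (convex_segment x y).segment_subset hu (right_mem_segment ℝ x y) hz
    refine Or.inl (hcone z hzxy hzB ?_)
    rw [mem_segment_iff_wbtw] at hu hz ⊢
    exact hu.trans_right_left hz
  · push Not at hmeet
    have huy : u ∈ connectedComponentIn P.boundaryᶜ y :=
      (convex_segment u y).isPreconnected.subset_connectedComponentIn (right_mem_segment ℝ u y)
        hmeet (left_mem_segment ℝ u y)
    rcases hyR with hyB | ⟨-, hyb⟩
    · exact absurd hyB (hmeet y (right_mem_segment ℝ u y))
    · exact Or.inr ⟨hmeet u (left_mem_segment ℝ u y), connectedComponentIn_eq huy ▸ hyb⟩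

end SimplePolygon

/-- The signed area of the parallelogram spanned by two plane vectors. -/
def cross (u v : Plane) : ℝ := u 0 * v 1 - u 1 * v 0

theorem cross_smul_add_smul_left (u v : Plane) (s t : ℝ) :
    cross (s • u + t • v) v = s * cross u v := by
  simp [cross]; ring

theorem cross_smul_add_smul_right (u v : Plane) (s t : ℝ) :
    cross u (s • u + t • v) = t * cross u v := by
  simp [cross]; ring

theorem eq_smul_add_smul_of_cross_ne_zero {u v : Plane} (h : cross u v ≠ 0) (z : Plane) :
    z = (cross z v / cross u v) • u + (cross u z / cross u v) • v := by
  ext i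
  fin_cases i <;> simp <;> field_simp <;> simp [cross] <;> ring

theorem exists_eq_smul_of_cross_eq_zero {u v : Plane} (hu : u ≠ 0) (h : cross u v = 0) :
    ∃ k : ℝ, v = k • u := by
  unfold cross at h
  by_cases h0 : u 0 = 0
  · have h1 : u 1 ≠ 0 := fun h1 => hu (by ext i; fin_cases i <;> simp [h0, h1])
    refine ⟨v 1 / u 1, ?_⟩
    have hv : v 0 = 0 := by
      rw [h0, zero_mul, zero_sub, neg_eq_zero] at h
      exact (mul_eq_zero.mp h).resolve_left h1
    ext i
    fin_cases i
    · simp [h0, hv]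
    · simp [h1]
  · refine ⟨v 0 / u 0, ?_⟩
    ext i
    fin_cases i
    · simp [h0]
    · simp; field_simp; linarith

theorem continuous_cross {X : Type*} [TopologicalSpace X] {f g : X → Plane} (hf : Continuous f)
    (hg : Continuous g) : Continuous fun z => cross (f z) (g z) := by
  unfold cross
  fun_prop

/-- The set of points that are joined to `w` by a segment inside `R`. -/
def visibleSet (R : Set Plane) (w : Plane) : Set Plane := {q | segment ℝ w q ⊆ R}

theorem visibleSet_subset (R : Set Plane) (w : Plane) : visibleSet R w ⊆ R :=
  fun q h => h (right_mem_segment ℝ w q)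

theorem segment_subset_visibleSet {R : Set Plane} {w q : Plane} (h : q ∈ visibleSet R w) :
    segment ℝ w q ⊆ visibleSet R w := fun _ hz =>
  ((convex_segment w q).segment_subset (left_mem_segment ℝ w q) hz).trans h

theorem isClosed_visibleSet {R : Set Plane} (hR : IsClosed R) (w : Plane) :
    IsClosed (visibleSet R w) := by
  have : visibleSet R w = ⋂ t ∈ Icc (0 : ℝ) 1, (fun q => w + t • (q - w)) ⁻¹' R := by
    ext q
    simp only [visibleSet, mem_ofPred_eq, segment_eq_image', image_subset_iff, mem_iInter]
    rfl
  rw [this]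
  exact isClosed_biInter fun t _ => hR.preimage (by fun_prop)

/-- A region with connected complement contains every triangle whose sides it contains. -/
theorem triangle_subset {R : Set Plane} (hb : Bornology.IsBounded R) (hc : IsPreconnected Rᶜ)
    {w p q : Plane} (hpq : cross (p - w) (q - w) ≠ 0) (hwp : segment ℝ w p ⊆ R)
    (hwq : segment ℝ w q ⊆ R) (hpqR : segment ℝ p q ⊆ R) {s t : ℝ} (hs : 0 ≤ s) (ht : 0 ≤ t)
    (hst : s + t ≤ 1) : w + (s • (p - w) + t • (q - w)) ∈ R := by
  set S : Plane → ℝ := fun z => cross (z - w) (q - w) / cross (p - w) (q - w) with hS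
  set T : Plane → ℝ := fun z => cross (p - w) (z - w) / cross (p - w) (q - w) with hT
  have hSc : Continuous S := (continuous_cross (by fun_prop) (by fun_prop)).div_const _
  have hTc : Continuous T := (continuous_cross (by fun_prop) (by fun_prop)).div_const _
  have hz : ∀ z, z = w + (S z • (p - w) + T z • (q - w)) := fun z => by
    rw [hS, hT, ← eq_smul_add_smul_of_cross_ne_zero hpq (z - w)]
    abel
  let O : Set Plane := {z | 0 < S z ∧ 0 < T z ∧ S z + T z < 1}
  let C : Set Plane := {z | 0 ≤ S z ∧ 0 ≤ T z ∧ S z + T z ≤ 1}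
  have hO : IsOpen O := (isOpen_lt continuous_const hSc).inter
    ((isOpen_lt continuous_const hTc).inter (isOpen_lt (hSc.add hTc) continuous_const))
  have hC : IsClosed C := (isClosed_le continuous_const hSc).inter
    ((isClosed_le continuous_const hTc).inter (isClosed_le (hSc.add hTc) continuous_const))
  have hOC : O ⊆ C := fun z h => ⟨h.1.le, h.2.1.le, h.2.2.le⟩
  have hsides : C \ O ⊆ R := by
    rintro z ⟨⟨h1, h2, h3⟩, hzO⟩
    rcases h1.eq_or_lt with h1' | h1'
    · refine hwq ?_
      rw [segment_eq_image']
      exact ⟨T z, ⟨h2, by linarith⟩, by conv_rhs => rw [hz z, ← h1', zero_smul, zero_add]⟩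
    rcases h2.eq_or_lt with h2' | h2'
    · refine hwp ?_
      rw [segment_eq_image']
      exact ⟨S z, ⟨h1, by linarith⟩, by conv_rhs => rw [hz z, ← h2', zero_smul, add_zero]⟩
    have h3' : S z + T z = 1 := h3.eq_of_not_lt fun h => hzO ⟨h1', h2', h⟩
    refine hpqR ⟨S z, T z, h1, h2, h3', ?_⟩
    conv_rhs => rw [hz z]
    have : S z = 1 - T z := by linarith
    rw [this]
    module
  have hcov : Rᶜ ⊆ O ∪ Cᶜ := by
    intro z hzR
    by_contra h
    rw [mem_union, not_or, mem_compl_iff, not_not] at h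
    exact hzR (hsides ⟨h.2, h.1⟩)
  have hRC : Rᶜ ⊆ Cᶜ := by
    refine (hc.subset_or_subset hO hC.isOpen_compl
      (disjoint_compl_right.mono_left hOC) hcov).resolve_left fun h => ?_
    refine not_isBounded_compl hb (Bornology.IsBounded.subset ?_ h)
    refine isBounded_iff_forall_norm_le.mpr ⟨‖w‖ + (‖p - w‖ + ‖q - w‖), fun z hzO => ?_⟩
    obtain ⟨h1, h2, h3⟩ := hzO
    conv_lhs => rw [hz z]
    have hSp : ‖S z • (p - w)‖ ≤ ‖p - w‖ := by
      rw [norm_smul, Real.norm_of_nonneg h1.le]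
      exact mul_le_of_le_one_left (norm_nonneg _) (by linarith)
    have hTq : ‖T z • (q - w)‖ ≤ ‖q - w‖ := by
      rw [norm_smul, Real.norm_of_nonneg h2.le]
      exact mul_le_of_le_one_left (norm_nonneg _) (by linarith)
    have hadd := norm_add_le w (S z • (p - w) + T z • (q - w))
    have hadd' := norm_add_le (S z • (p - w)) (T z • (q - w))
    linarith
  refine compl_subset_compl.mp hRC ?_
  have h1 : S (w + (s • (p - w) + t • (q - w))) = s := by
    simp only [hS, add_sub_cancel_left, cross_smul_add_smul_left]
    exact mul_div_cancel_right₀ s hpq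
  have h2 : T (w + (s • (p - w) + t • (q - w))) = t := by
    simp only [hT, add_sub_cancel_left, cross_smul_add_smul_right]
    exact mul_div_cancel_right₀ t hpq
  exact ⟨h1.symm ▸ hs, h2.symm ▸ ht, by rw [h1, h2]; exact hst⟩

theorem triangle_subset_visibleSet {R : Set Plane} (hb : Bornology.IsBounded R)
    (hc : IsPreconnected Rᶜ) {w p q : Plane} (hpq : cross (p - w) (q - w) ≠ 0)
    (hwp : segment ℝ w p ⊆ R) (hwq : segment ℝ w q ⊆ R) (hpqR : segment ℝ p q ⊆ R) {s t : ℝ}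
    (hs : 0 ≤ s) (ht : 0 ≤ t) (hst : s + t ≤ 1) :
    w + (s • (p - w) + t • (q - w)) ∈ visibleSet R w := by
  intro z hz
  rw [segment_eq_image'] at hz
  obtain ⟨θ, ⟨h0, h1⟩, rfl⟩ := hz
  have := triangle_subset hb hc hpq hwp hwq hpqR (mul_nonneg h0 hs) (mul_nonneg h0 ht)
    (by nlinarith)
  convert this using 1
  module

/-- A chord whose line misses `w` and whose endpoints see `w` lies inside the interior of the
visibility region of `w`. -/
theorem mem_interior_visibleSet {R : Set Plane} (hb : Bornology.IsBounded R)
    (hc : IsPreconnected Rᶜ) {w a b x : Plane} (hab : cross (a - w) (b - w) ≠ 0)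
    (ha : a ∈ visibleSet R w) (hb' : b ∈ visibleSet R w) (habR : segment ℝ a b ⊆ R)
    (hx : x ∈ openSegment ℝ a b) (hxR : x ∈ interior R) : x ∈ interior (visibleSet R w) := by
  obtain ⟨u, v, hu, hv, huv, hxe⟩ := hx
  set S : Plane → ℝ := fun z => cross (z - w) (b - w) / cross (a - w) (b - w) with hS
  set T : Plane → ℝ := fun z => cross (a - w) (z - w) / cross (a - w) (b - w) with hT
  have hSc : Continuous S := (continuous_cross (by fun_prop) (by fun_prop)).div_const _
  have hTc : Continuous T := (continuous_cross (by fun_prop) (by fun_prop)).div_const _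
  have hz : ∀ z, z = w + (S z • (a - w) + T z • (b - w)) := fun z => by
    rw [hS, hT, ← eq_smul_add_smul_of_cross_ne_zero hab (z - w)]
    abel
  have hxw : x - w = u • (a - w) + v • (b - w) := by
    have : v = 1 - u := by linarith
    rw [← hxe, this]
    module
  have hSx : S x = u := by
    simp only [hS, hxw, cross_smul_add_smul_left]
    exact mul_div_cancel_right₀ u hab
  have hTx : T x = v := by
    simp only [hT, hxw, cross_smul_add_smul_right]
    exact mul_div_cancel_right₀ v hab
  have hσx : S x + T x = 1 := by rw [hSx, hTx, huv]
  obtain ⟨r, hr, hrR⟩ := Metric.isOpen_iff.mp isOpen_interior x hxR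
  have hcx : ContinuousAt (fun z => w + (S z + T z)⁻¹ • (z - w)) x :=
    continuousAt_const.add (((hSc.add hTc).continuousAt.inv₀
      (by simp [hσx])).smul (by fun_prop))
  have hcball : ∀ᶠ z in nhds x, w + (S z + T z)⁻¹ • (z - w) ∈ Metric.ball x r :=
    hcx (by
      beta_reduce
      rw [hσx, inv_one, one_smul, add_sub_cancel]
      exact Metric.ball_mem_nhds x hr)
  rw [mem_interior_iff_mem_nhds]
  filter_upwards [Metric.ball_mem_nhds x hr, hcball,
    hSc.continuousAt.eventually (lt_mem_nhds (hSx.symm ▸ hu)),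
    hTc.continuousAt.eventually (lt_mem_nhds (hTx.symm ▸ hv))] with z hzb hcz hSz hTz
  intro y hy
  rw [segment_eq_image'] at hy
  obtain ⟨θ, ⟨h0, h1⟩, rfl⟩ := hy
  have hσ : 0 < S z + T z := by linarith
  rcases le_or_gt (θ * (S z + T z)) 1 with h | h
  · have := triangle_subset hb hc hab ha hb' habR (mul_nonneg h0 hSz.le) (mul_nonneg h0 hTz.le)
      (by linarith)
    convert this using 1
    nth_rewrite 1 [hz z]
    module
  · refine interior_subset (hrR ((convex_ball x r).segment_subset hcz hzb ?_))
    have hσ1 : 1 < S z + T z := by nlinarith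
    have hd : S z + T z - 1 ≠ 0 := by linarith
    refine ⟨(1 - θ) * (S z + T z) / (S z + T z - 1), (θ * (S z + T z) - 1) / (S z + T z - 1),
      div_nonneg (mul_nonneg (by linarith) hσ.le) (by linarith),
      div_nonneg (by linarith) (by linarith), by field_simp; ring, ?_⟩
    have e1 : (1 - θ) * (S z + T z) / (S z + T z - 1) +
      (θ * (S z + T z) - 1) / (S z + T z - 1) = 1 := by field_simp; ring
    have e2 : (1 - θ) * (S z + T z) / (S z + T z - 1) * (S z + T z)⁻¹ +
      (θ * (S z + T z) - 1) / (S z + T z - 1) = θ := by field_simp; ring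
    generalize (1 - θ) * (S z + T z) / (S z + T z - 1) = A at *
    generalize (θ * (S z + T z) - 1) / (S z + T z - 1) = B at *
    rw [← e2]
    have : B = 1 - A := by linarith
    rw [this]
    module

theorem exists_mem_cross_ne_zero {O : Set Plane} (hO : IsOpen O) (hne : O.Nonempty) {d : Plane}
    (hd : d ≠ 0) (w : Plane) : ∃ z ∈ O, cross d (z - w) ≠ 0 := by
  obtain ⟨y, hy⟩ := hne
  by_contra! h
  have hev : ∀ m : Plane, ∀ᶠ ε : ℝ in nhds 0, y + ε • m ∈ O := fun m =>
    (show Continuous fun ε : ℝ => y + ε • m by fun_prop).continuousAt.eventually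
      (by simpa using hO.mem_nhds hy)
  have key : ∀ m : Plane, cross d m = 0 := by
    intro m
    obtain ⟨ε, hε, hε0⟩ := (((hev m).filter_mono nhdsWithin_le_nhds).and
      (self_mem_nhdsWithin : Ioi (0 : ℝ) ∈ nhdsWithin 0 (Ioi 0))).exists
    have h1 := h y hy
    have h2 := h _ hε
    have h3 : ε * cross d m = 0 := by
      simp only [cross, PiLp.add_apply, PiLp.sub_apply, PiLp.smul_apply, smul_eq_mul] at h1 h2 ⊢
      linarith
    exact (mul_eq_zero.mp h3).resolve_left (ne_of_gt hε0)
  refine hd ?_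
  have k0 := key !₂[1, 0]
  have k1 := key !₂[0, 1]
  simp [cross] at k0 k1
  ext i
  fin_cases i <;> simp [k0, k1]

/-- Along a chord on a line through `w`, all points on one side of the chord near a suitable
point of the chord are visible from `w`. -/
theorem exists_visible_side {R : Set Plane} (hb : Bornology.IsBounded R) (hc : IsPreconnected Rᶜ)
    {w d : Plane} (hd : d ≠ 0) {k : ℝ} (hk : 1 < k)
    (hvis : segment ℝ (w + d) (w + k • d) ⊆ visibleSet R w)
    (hint : openSegment ℝ (w + d) (w + k • d) ⊆ interior R)
    (hreg : visibleSet R w ⊆ closure (interior (visibleSet R w))) :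
    ∃ x ∈ openSegment ℝ (w + d) (w + k • d), ∃ n, cross d n ≠ 0 ∧
      ∀ᶠ z in nhds x, 0 ≤ cross d (z - w) / cross d n → z ∈ visibleSet R w := by
  have hmem : ∀ θ ∈ Ioo (0 : ℝ) 1,
      w + (1 + θ * (k - 1)) • d ∈ openSegment ℝ (w + d) (w + k • d) := fun θ hθ => by
    rw [openSegment_eq_image']
    exact ⟨θ, hθ, by module⟩
  have hx := hmem (1 / 3) ⟨by norm_num, by norm_num⟩
  have hx' := hmem (2 / 3) ⟨by norm_num, by norm_num⟩
  set x' : Plane := w + (1 + 2 / 3 * (k - 1)) • d with hx'e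
  set x : Plane := w + (1 + 1 / 3 * (k - 1)) • d with hxe
  obtain ⟨r, hr, hrR⟩ := Metric.isOpen_iff.mp isOpen_interior x' (hint hx')
  have hx'v := hvis (openSegment_subset_segment ℝ _ _ hx')
  obtain ⟨q, ⟨hqr, hqv⟩, hq⟩ := exists_mem_cross_ne_zero
    (Metric.isOpen_ball.inter isOpen_interior)
    (mem_closure_iff.mp (hreg hx'v) _ Metric.isOpen_ball (Metric.mem_ball_self hr)) hd w
  refine ⟨x, hx, q - w, hq, ?_⟩
  have hτ' : (1 + 2 / 3 * (k - 1)) ≠ 0 := by linarith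
  have hx'w : x' - w = (1 + 2 / 3 * (k - 1)) • d := by rw [hx'e]; abel
  have hcr : ∀ m, cross (x' - w) m = (1 + 2 / 3 * (k - 1)) * cross d m := fun m => by
    rw [hx'w]; simp [cross]; ring
  have hne : cross (x' - w) (q - w) ≠ 0 := by
    rw [hcr]; exact mul_ne_zero hτ' hq
  set S : Plane → ℝ := fun z => cross (z - w) (q - w) / cross (x' - w) (q - w) with hS
  set T : Plane → ℝ := fun z => cross (x' - w) (z - w) / cross (x' - w) (q - w) with hT
  have hSc : Continuous S := (continuous_cross (by fun_prop) (by fun_prop)).div_const _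
  have hTc : Continuous T := (continuous_cross (by fun_prop) (by fun_prop)).div_const _
  have hxw : x - w = ((1 + 1 / 3 * (k - 1)) / (1 + 2 / 3 * (k - 1))) • (x' - w) +
      (0 : ℝ) • (q - w) := by
    rw [hx'w, smul_smul, div_mul_cancel₀ _ hτ', hxe]
    module
  have hSx : S x = (1 + 1 / 3 * (k - 1)) / (1 + 2 / 3 * (k - 1)) := by
    simp only [hS, hxw, cross_smul_add_smul_left]
    exact mul_div_cancel_right₀ _ hne
  have hTx : T x = 0 := by
    simp only [hT, hxw, cross_smul_add_smul_right, zero_mul, zero_div]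
  have hSpos : 0 < S x := by rw [hSx]; exact div_pos (by linarith) (by linarith)
  have hSlt : S x + T x < 1 := by
    rw [hSx, hTx, add_zero, div_lt_one (by linarith)]; linarith
  filter_upwards [hSc.continuousAt.eventually (lt_mem_nhds hSpos),
    (hSc.add hTc).continuousAt.eventually (gt_mem_nhds hSlt)] with z hSz hSTz hside
  have hTz : 0 ≤ T z := by
    simp only [hT, hcr]
    rwa [mul_div_mul_left _ _ hτ']
  have := triangle_subset_visibleSet hb hc hne hx'v (interior_subset hqv)
    (((convex_ball x' r).segment_subset (Metric.mem_ball_self hr) hqr).trans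
      (hrR.trans interior_subset)) hSz.le hTz hSTz.le
  rwa [hS, hT, ← eq_smul_add_smul_of_cross_ne_zero hne (z - w), add_sub_cancel] at this

theorem crosscut_separates_plane {R : Set Plane} (hR : IsPreconnected Rᶜ) {a b x p q : Plane}
    (ha : a ∈ frontier R) (hb : b ∈ frontier R) {D : Set Plane} (hD : Convex ℝ D)
    (hDR : D ⊆ interior R) (hx : x ∈ D) (hxab : x ∈ openSegment ℝ a b) (hp : p ∈ D) (hq : q ∈ D)
    (hpi : 0 < cross (p - b) (p - a)) (hqi : cross (q - b) (q - a) < 0) :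
    ¬ JoinedIn (R \ segment ℝ a b) p q := by
  intro h
  let c : Plane ≃ₗᵢ[ℝ] ℂ := Complex.orthonormalBasisOneI.repr.symm
  have hcre : ∀ z, (c z).re = z 0 := fun z => by
    simp [c, Complex.orthonormalBasisOneI_repr_symm_apply]
  have hcim : ∀ z, (c z).im = z 1 := fun z => by
    simp [c, Complex.orthonormalBasisOneI_repr_symm_apply]
  have hseg : ∀ u v, c '' segment ℝ u v = segment ℝ (c u) (c v) := fun u v =>
    image_segment ℝ c.toLinearEquiv.toLinearMap.toAffineMap u v
  have hoseg : ∀ u v, c '' openSegment ℝ u v = openSegment ℝ (c u) (c v) := fun u v =>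
    image_openSegment ℝ c.toLinearEquiv.toLinearMap.toAffineMap u v
  have hfr := c.toHomeomorph.image_frontier R
  have hin := c.toHomeomorph.image_interior R
  have hcompl : c '' Rᶜ = (c '' R)ᶜ := image_compl_eq c.bijective
  have h' := h.map c.continuous
  rw [image_sdiff c.injective, hseg] at h'
  refine crosscut_separates (R := c '' R) (x := c x) (D := c '' D)
    (hcompl ▸ hR.image c c.continuous.continuousOn) (hfr ▸ mem_image_of_mem _ ha)
    (hfr ▸ mem_image_of_mem _ hb) (hD.linear_image c.toLinearEquiv.toLinearMap)
    (hin ▸ image_mono hDR) (mem_image_of_mem _ hx) (hoseg a b ▸ mem_image_of_mem _ hxab)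
    (mem_image_of_mem _ hp) (mem_image_of_mem _ hq) ?_ ?_ h'
  · simp only [Complex.sub_re, Complex.sub_im, hcre, hcim]
    simp only [cross, PiLp.sub_apply] at hpi
    linarith
  · simp only [Complex.sub_re, Complex.sub_im, hcre, hcim]
    simp only [cross, PiLp.sub_apply] at hqi
    linarith

/-- In a locally star-shaped region minus a closed set, preconnected sets are path connected. -/
theorem IsPreconnected.joinedIn_diff {R e N : Set Plane} (he : IsClosed e)
    (hstar : ∀ x, ∃ r > 0, ∀ y ∈ Metric.ball x r, y ∈ R → segment ℝ x y ⊆ R)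
    (hN : IsPreconnected N) (hNR : N ⊆ R \ e) {x y : Plane} (hx : x ∈ N) (hy : y ∈ N) :
    JoinedIn (R \ e) x y := by
  refine hN.induction₂ (JoinedIn (R \ e)) ?_ (fun _ _ _ _ _ _ => JoinedIn.trans)
    (fun _ _ _ _ => JoinedIn.symm) hx hy
  intro z hz
  obtain ⟨r, hr, hrR⟩ := hstar z
  obtain ⟨s, hs, hse⟩ := Metric.isOpen_iff.mp he.isOpen_compl z (hNR hz).2
  filter_upwards [inter_mem_nhdsWithin N (Metric.ball_mem_nhds z (lt_min hr hs))] with u hu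
  have hub := Metric.mem_ball.mp hu.2
  refine JoinedIn.of_segment_subset (subset_sdiff.mpr ⟨hrR u
    (Metric.mem_ball.mpr (hub.trans_le (min_le_left _ _))) (hNR hu.1).1, ?_⟩)
  exact disjoint_left.mpr fun t ht => hse ((convex_ball z s).segment_subset
    (Metric.mem_ball_self hs) (Metric.mem_ball.mpr (hub.trans_le (min_le_right _ _))) ht)

theorem not_joinedIn_of_window_of_lt {R : Set Plane} (hb : Bornology.IsBounded R)
    (hc : IsPreconnected Rᶜ) {w d : Plane} (hd : d ≠ 0) {k : ℝ} (hk : 1 < k)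
    (hvis : segment ℝ (w + d) (w + k • d) ⊆ visibleSet R w)
    (hint : openSegment ℝ (w + d) (w + k • d) ⊆ interior R)
    (ha : w + d ∈ frontier R) (hb' : w + k • d ∈ frontier R)
    (hreg : visibleSet R w ⊆ closure (interior (visibleSet R w)))
    (hw : w ∉ segment ℝ (w + d) (w + k • d)) {N : Set Plane} (hNw : Disjoint N (visibleSet R w))
    (heN : segment ℝ (w + d) (w + k • d) ⊆ closure N) :
    ∃ y ∈ N, ¬ JoinedIn (R \ segment ℝ (w + d) (w + k • d)) w y := by
  obtain ⟨x, hx, n, hn, hev⟩ := exists_visible_side hb hc hd hk hvis hint hreg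
  obtain ⟨r, hr, hrR⟩ := Metric.isOpen_iff.mp isOpen_interior x (hint hx)
  have hcross : ∀ z, cross (z - (w + k • d)) (z - (w + d)) = (1 - k) * cross d (z - w) := by
    intro z
    simp [cross]; ring
  have hline : ∀ z ∈ segment ℝ (w + d) (w + k • d), cross d (z - w) = 0 := by
    rintro z ⟨s, t, -, -, hst, rfl⟩
    have : s = 1 - t := by linarith
    subst this
    simp [cross]; ring
  have hx0 := hline x (openSegment_subset_segment ℝ _ _ hx)
  obtain ⟨y, ⟨hyv, hyr⟩, hyN⟩ := mem_closure_iff_nhds.mp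
    (heN (openSegment_subset_segment ℝ _ _ hx)) _
    (Filter.inter_mem hev (Metric.ball_mem_nhds x hr))
  have hy : cross d (y - w) / cross d n < 0 := by
    by_contra! h
    exact hNw.le_bot ⟨hyN, hyv h⟩
  have hqev : ∀ᶠ ε : ℝ in nhds 0, (0 ≤ cross d (x + ε • n - w) / cross d n →
      x + ε • n ∈ visibleSet R w) ∧ x + ε • n ∈ Metric.ball x r :=
    (show Continuous fun ε : ℝ => x + ε • n by fun_prop).tendsto' 0 x (by simp)
      |>.eventually (hev.and (Metric.ball_mem_nhds x hr))
  obtain ⟨ε, ⟨hqv, hqr⟩, hε⟩ := ((hqev.filter_mono nhdsWithin_le_nhds).and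
    (self_mem_nhdsWithin : Ioi (0 : ℝ) ∈ nhdsWithin 0 (Ioi 0))).exists
  have hq : cross d (x + ε • n - w) = ε * cross d n := by
    have : cross d (x + ε • n - w) = cross d (x - w) + ε * cross d n := by
      simp [cross]; ring
    rw [this, hx0, zero_add]
  set q := x + ε • n
  rw [hq, mul_div_cancel_right₀ _ hn] at hqv
  have hwq : JoinedIn (R \ segment ℝ (w + d) (w + k • d)) w q := by
    refine JoinedIn.of_segment_subset (subset_sdiff.mpr ⟨hqv (le_of_lt hε), ?_⟩)
    refine disjoint_left.mpr fun z hz hze => ?_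
    have h0 := hline z hze
    rw [segment_eq_image'] at hz
    obtain ⟨θ, -, rfl⟩ := hz
    have h1 : cross d (w + θ • (q - w) - w) = θ * cross d (q - w) := by
      simp [cross]; ring
    rw [h1, hq, mul_eq_zero, mul_eq_zero] at h0
    rcases h0 with h0 | h0 | h0
    · exact hw (by simpa [h0] using hze)
    · exact ne_of_gt hε h0
    · exact hn h0
  refine ⟨y, hyN, fun hwy => ?_⟩
  have hyq := hwy.symm.trans hwq
  have hεn : 0 < ε := hε
  rcases lt_or_gt_of_ne hn with h | h
  · have hy' : 0 < cross d (y - w) := by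
      by_contra! h'
      exact hy.not_ge (div_nonneg_of_nonpos h' h.le)
    refine crosscut_separates_plane hc ha hb' (convex_ball x r) hrR (Metric.mem_ball_self hr) hx
      hqr hyr ?_ ?_ hyq.symm
    · rw [hcross, hq]
      nlinarith [mul_neg_of_pos_of_neg hεn h]
    · rw [hcross]
      nlinarith
  · have hy' : cross d (y - w) < 0 := by
      by_contra! h'
      exact hy.not_ge (div_nonneg h' h.le)
    refine crosscut_separates_plane hc ha hb' (convex_ball x r) hrR (Metric.mem_ball_self hr) hx
      hyr hqr ?_ ?_ hyq
    · rw [hcross]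
      nlinarith
    · rw [hcross, hq]
      nlinarith [mul_pos hεn h]

/-- A chord of `R` on the frontier of the visibility region of `w` separates `w` from some point
of every set that accumulates at the chord without being visible from `w`. -/
theorem exists_not_joinedIn_of_window {R : Set Plane} (hR : IsClosed R)
    (hb : Bornology.IsBounded R) (hc : IsPreconnected Rᶜ) {w a b : Plane} (hab : a ≠ b)
    (hvis : segment ℝ a b ⊆ frontier (visibleSet R w))
    (hfr : segment ℝ a b ∩ frontier R = {a, b})
    (hreg : visibleSet R w ⊆ closure (interior (visibleSet R w)))
    (hw : w ∉ segment ℝ a b) {N : Set Plane} (hNw : Disjoint N (visibleSet R w))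
    (heN : segment ℝ a b ⊆ closure N) : ∃ y ∈ N, ¬ JoinedIn (R \ segment ℝ a b) w y := by
  have hvis' : segment ℝ a b ⊆ visibleSet R w :=
    hvis.trans (isClosed_visibleSet hR w).frontier_subset
  have ha : a ∈ frontier R := (hfr.ge (by simp) : a ∈ segment ℝ a b ∩ frontier R).2
  have hb' : b ∈ frontier R := (hfr.ge (by simp) : b ∈ segment ℝ a b ∩ frontier R).2
  have hint : openSegment ℝ a b ⊆ interior R := by
    intro x hx
    have hxs := openSegment_subset_segment ℝ a b hx
    by_contra h
    have hxf : x ∈ ({a, b} : Set Plane) :=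
      hfr.le ⟨hxs, subset_closure (visibleSet_subset R w (hvis' hxs)), h⟩
    rcases hxf with rfl | rfl
    · exact hab (left_mem_openSegment_iff.mp hx)
    · exact hab (right_mem_openSegment_iff.mp hx)
  have hcr : cross (a - w) (b - w) = 0 := by
    by_contra h
    have hm : midpoint ℝ a b ∈ openSegment ℝ a b := by
      rw [openSegment_eq_image_lineMap]
      exact ⟨2⁻¹, by norm_num, by simp [midpoint]⟩
    exact (hvis (openSegment_subset_segment ℝ _ _ hm)).2 (mem_interior_visibleSet hb hc h
      (hvis' (left_mem_segment ℝ a b)) (hvis' (right_mem_segment ℝ a b))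
      (hvis'.trans (visibleSet_subset R w)) hm (hint hm))
  have haw : a - w ≠ 0 := fun h => hw (sub_eq_zero.mp h ▸ left_mem_segment ℝ a b)
  obtain ⟨k, hk⟩ := exists_eq_smul_of_cross_eq_zero haw hcr
  have hae : a = w + (a - w) := by abel
  have hbe : b = w + k • (a - w) := by rw [← hk]; abel
  have hk0 : 0 < k := by
    by_contra! h
    refine hw ⟨-k / (1 - k), 1 / (1 - k), div_nonneg (by linarith) (by linarith),
      div_nonneg (by linarith) (by linarith), by
        have : 1 - k ≠ 0 := by linarith
        field_simp; ring, ?_⟩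
    have h1k : 1 - k ≠ 0 := by linarith
    have e1 : -k / (1 - k) + 1 / (1 - k) = 1 := by field_simp; ring
    have e2 : -k / (1 - k) + 1 / (1 - k) * k = 0 := by field_simp; ring
    have e3 : -k / (1 - k) = 1 - 1 / (1 - k) := by linarith
    calc _ = w + (-k / (1 - k) + 1 / (1 - k) * k) • (a - w) := by
          conv_lhs => rw [hbe]
          rw [e3]; module
      _ = w := by rw [e2, zero_smul, add_zero]
  rcases lt_trichotomy k 1 with hk1 | hk1 | hk1
  · have hbw : b - w ≠ 0 := by
      rw [hk]; exact smul_ne_zero hk0.ne' haw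
    have hae' : a = w + k⁻¹ • (b - w) := by
      rw [hk, inv_smul_smul₀ hk0.ne']; abel
    have hbe' : b = w + (b - w) := by abel
    rw [openSegment_symm] at hint
    rw [segment_symm] at hvis' hw heN ⊢
    generalize b - w = d at hae' hbe' hbw
    subst hae' hbe'
    exact not_joinedIn_of_window_of_lt hb hc hbw ((one_lt_inv₀ hk0).mpr hk1) hvis' hint hb' ha
      hreg hw hNw heN
  · exact absurd (by rw [hbe, hk1, one_smul]; abel) hab
  · generalize a - w = d at hae hbe haw
    subst hae hbe
    exact not_joinedIn_of_window_of_lt hb hc haw hk1 hvis' hint ha hb' hreg hw hNw heN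

namespace SimplePolygon

theorem Vis_eq_visibleSet (P : SimplePolygon) (p : Plane) : P.Vis p = visibleSet P.region p :=
  subset_antisymm (fun _ h => h.2) fun _ h => ⟨visibleSet_subset _ _ h, h⟩

theorem NVis_union_Vis_subset_region (P : SimplePolygon) (W : Set Plane) (w v : Plane) :
    P.Vis w ∪ P.NVis W ∪ P.Vis v ⊆ P.region :=
  union_subset (union_subset (fun _ h => h.1) fun _ h => h.1) fun _ h => h.1

/-- Paths inside the polygon from `w` to `v` cross every window of `Vis w` in the closure of a
non-visible component attached to `Vis v`. -/
theorem path_meets_window (P : SimplePolygon) {W : Set Plane} (hW : P.IsWitnessSet W)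
    {w v : Plane} (hw : w ∈ W) (hv : v ∈ W) (hwv : w ≠ v) (hreg : P.VisRegular w)
    {NV : Set Plane} (hNV : IsCompOf NV (P.NVis W)) (hav : P.Attached NV v)
    {e : Set Plane} (he : P.IsWindow w e) (heNV : e ⊆ closure NV)
    (f : Path w v) (hf : range f ⊆ P.region) : (range f ∩ e).Nonempty := by
  obtain ⟨a, b, hab, rfl, hvis, hfr, -⟩ := he
  obtain ⟨x₀, -, hNVe⟩ := hNV
  have hNVc : IsPreconnected NV := hNVe ▸ isPreconnected_connectedComponentIn
  have hNVs : NV ⊆ P.NVis W := hNVe ▸ connectedComponentIn_subset _ _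
  have hdisj := disjoint_iff_inter_eq_empty.mpr (hW.2.2 w hw v hv hwv)
  obtain ⟨z, hzN, hzv⟩ := hav
  unfold VisRegular at hreg
  rw [Vis_eq_visibleSet] at hreg hvis hdisj
  rw [Vis_eq_visibleSet] at hzv hdisj
  have hvis' := hvis.trans (isClosed_visibleSet P.isClosed_region w).frontier_subset
  by_contra hmeet
  have hfe : ∀ t, f t ∈ P.region \ segment ℝ a b := fun t =>
    ⟨hf ⟨t, rfl⟩, fun h => hmeet ⟨f t, ⟨t, rfl⟩, h⟩⟩
  have hwe : w ∉ segment ℝ a b := by simpa using (hfe 0).2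
  have hNw : Disjoint NV (visibleSet P.region w) := disjoint_left.mpr fun y hy hyw => by
    rw [← Vis_eq_visibleSet] at hyw
    exact (hNVs hy).2 (mem_biUnion hw hyw)
  obtain ⟨y, hyN, hy⟩ := exists_not_joinedIn_of_window P.isClosed_region P.isBounded_region
    P.isPreconnected_compl_region hab hvis hfr hreg.le hwe hNw heNV
  have hve : visibleSet P.region v ⊆ P.region \ segment ℝ a b :=
    subset_sdiff.mpr ⟨visibleSet_subset _ _, (hdisj.mono_left hvis').symm⟩
  have hzy : JoinedIn (P.region \ segment ℝ a b) z y := by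
    refine IsPreconnected.joinedIn_diff (isCompact_segment a b).isClosed
      P.exists_ball_segment_subset_region (N := insert z NV)
      (hNVc.subset_closure (subset_insert z NV) (insert_subset hzN subset_closure))
      (insert_subset (hve hzv) (subset_sdiff.mpr ⟨fun u hu => (hNVs hu).1,
        hNw.mono_right hvis'⟩)) (mem_insert z NV) (mem_insert_of_mem z hyN)
  have hvz : JoinedIn (P.region \ segment ℝ a b) v z :=
    JoinedIn.of_segment_subset ((segment_subset_visibleSet hzv).trans hve)
  have hwf : JoinedIn (P.region \ segment ℝ a b) w v := ⟨f, hfe⟩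
  exact hy (hwf.trans (hvz.trans hzy))

end SimplePolygon

/-- Every neighbor witness path between neighbor witnesses `w` and `v`
intersects the attachment windows of both visibility regions. -/
theorem nwpath_meets_windows (P : SimplePolygon) (W : Set Plane)
    (hW : P.IsWitnessSet W) (hreg : ∀ u ∈ W, P.VisRegular u)
    (w v : Plane) (hadj : P.GConAdj W w v)
    (NV : Set Plane) (hNV : IsCompOf NV (P.NVis W))
    (haw : P.Attached NV w) (hav : P.Attached NV v)
    (ew ev : Set Plane) (hew : P.IsWindow w ew) (hev : P.IsWindow v ev)
    (hewNV : ew ⊆ closure NV) (hevNV : ev ⊆ closure NV)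
    (γ : Set Plane) (hγ : P.IsNWPath W w v γ) :
    (γ ∩ ew).Nonempty ∧ (γ ∩ ev).Nonempty := by
  obtain ⟨hw, hv, hwv, -⟩ := hadj
  obtain ⟨f, rfl, hf⟩ := hγ
  have hf' := hf.trans (P.NVis_union_Vis_subset_region W w v)
  refine ⟨P.path_meets_window hW hw hv hwv (hreg w hw) hNV hav hew hewNV f hf', ?_⟩
  have h := P.path_meets_window hW hv hw hwv.symm (hreg v hv) hNV haw hev hevNV f.symm
    (by rwa [Path.symm_range])
  rwa [Path.symm_range] at h
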